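/- In the hidden-variable game with loopholes closed, Scientist AB has a strategy (a rule determining, from the history λ_1, …, λ_{n−1} of Nature's previous moves, the bets {q_n^{AB}(·,·|s,t) ∈ P(Ω²)}_{(s,t)∈Θ} and the setting pair (s_n,t_n) ∈ Θ) under which every setting pair in Θ is chosen infinitely often, and such that for every sequence λ : ℕ≥1 → Λ of Nature's moves, with outcomes (ω_n^{s_n}, ω_n^{t_n}) := (X_{s_n}(λ_n), X_{t_n}(λ_n)) and capital K_0^{AB} = 1, K_n^{AB} = K_{n−1}^{AB} · q_n^{AB}(ω_n^{s_n}, ω_n^{t_n}|s_n,t_n) / p(ω_n^{s_n}, ω_n^{t_n}|s_n,t_n), the following holds: either K_n^{AB} → ∞, or for all (s,t) ∈ Θ and all a,b ∈ Ω, #{i ≤ n : (ω_i^{s_i}, ω_i^{t_i}, s_i, t_i) = (a,b,s,t)} / #{i ≤ n : (s_i,t_i) = (s,t)} → p(a,b|s,t) as n → ∞. -/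

import Mathlib

open Filter

/-- The two-point set `{+1, -1}` of measurement outcomes. -/
abbrev Sign := ({1, -1} : Finset ℤ)

/-- The set of joint measurement settings `Θ = {1,2} × {3,4}`. -/
def ThetaF : Finset (ℕ × ℕ) := ({1, 2} : Finset ℕ) ×ˢ ({3, 4} : Finset ℕ)

noncomputable def mu : ℝ := (2 - Real.sqrt 2) / 8
noncomputable def nu : ℝ := (2 + Real.sqrt 2) / 8

/-- The CHSH table `p(a,b|s,t)`. -/
noncomputable def chshP (a b : Sign) (s t : ℕ) : ℝ :=
  if s = 1 ∧ t = 4 then (if a = b then nu else mu) else (if a = b then mu else nu)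

/-- The history `λ₁ ⋯ λ_m` of Nature's first `m` moves, as a list. -/
def hist {Λ : Type*} (lam : ℕ → Λ) (m : ℕ) : List Λ :=
  (List.range m).map fun i => lam (i + 1)

/-- The CHSH probability of an outcome pair under a setting pair. -/
noncomputable def cellProb (st : ℕ × ℕ) (ω : Sign × Sign) : ℝ := chshP ω.1 ω.2 st.1 st.2

lemma cellProb_pos (st : ℕ × ℕ) (ω : Sign × Sign) : 0 < cellProb st ω := by
  have h0 : 0 ≤ √(2 : ℝ) := Real.sqrt_nonneg 2
  have h2 : √(2 : ℝ) < 2 := by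
    rw [Real.sqrt_lt' (by norm_num)]; norm_num
  have hmu : 0 < mu := by unfold mu; linarith
  have hnu : 0 < nu := by unfold nu; linarith
  unfold cellProb chshP
  split_ifs <;> assumption

lemma sum_sign (f : Sign → ℝ) :
    ∑ a : Sign, f a = f ⟨1, by decide⟩ + f ⟨-1, by decide⟩ := by
  have h : (Finset.univ : Finset Sign) = {⟨1, by decide⟩, ⟨-1, by decide⟩} := by decide
  rw [h, Finset.sum_pair (by decide)]

lemma sum_cellProb (st : ℕ × ℕ) : ∑ ω, cellProb st ω = 1 := by
  simp only [Fintype.sum_prod_type, sum_sign, cellProb, chshP, mu, nu]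
  by_cases h : st.1 = 1 ∧ st.2 = 4 <;> simp [h] <;> ring

lemma sum_cellProb_sq (st : ℕ × ℕ) : ∑ ω, cellProb st ω ^ 2 = 3 / 8 := by
  have h : √(2 : ℝ) ^ 2 = 2 := Real.sq_sqrt (by norm_num)
  simp only [Fintype.sum_prod_type, sum_sign, cellProb, chshP, mu, nu]
  by_cases hst : st.1 = 1 ∧ st.2 = 4 <;> simp [hst] <;> ring_nf <;> rw [h] <;> norm_num

lemma cellProb_le_one (st : ℕ × ℕ) (ω : Sign × Sign) : cellProb st ω ≤ 1 :=
  (Finset.single_le_sum (fun i _ => (cellProb_pos st i).le) (Finset.mem_univ ω)).trans_eq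
    (sum_cellProb st)

/-- The outcome indicator of `ω`, centred at the CHSH probabilities, as a function of the cell. -/
noncomputable def centered (st : ℕ × ℕ) (ω ω' : Sign × Sign) : ℝ :=
  (if ω' = ω then 1 else 0) - cellProb st ω'

lemma abs_centered_le (st : ℕ × ℕ) (ω ω' : Sign × Sign) : |centered st ω ω'| ≤ 1 := by
  have h0 := cellProb_pos st ω'
  have h1 := cellProb_le_one st ω'
  unfold centered
  rw [abs_le]
  split_ifs <;> constructor <;> linarith

/-- The expected increase of the squared norm of a vector after adding a centred indicator is the
variance. -/
lemma expected_sq_increase (st : ℕ × ℕ) (D : Sign × Sign → ℝ) :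
    ∑ ω, cellProb st ω * (∑ ω', (D ω' + centered st ω ω') ^ 2 - ∑ ω', D ω' ^ 2) = 5 / 8 := by
  have key (ω : Sign × Sign) : ∑ ω', (D ω' + centered st ω ω') ^ 2 - ∑ ω', D ω' ^ 2 =
      2 * D ω - 2 * cellProb st ω + 1 +
        (∑ ω', cellProb st ω' ^ 2 - 2 * ∑ ω', cellProb st ω' * D ω') := by
    have h (ω' : Sign × Sign) : (D ω' + centered st ω ω') ^ 2 = D ω' ^ 2 +
        (if ω' = ω then 2 * D ω' - 2 * cellProb st ω' + 1 else 0) +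
        (cellProb st ω' ^ 2 - 2 * (cellProb st ω' * D ω')) := by
      unfold centered; split_ifs <;> ring
    simp only [h, Finset.sum_add_distrib, Finset.sum_sub_distrib, Finset.sum_ite_eq',
      Finset.mem_univ, if_true, ← Finset.mul_sum]
    ring
  have h (ω : Sign × Sign) :
      cellProb st ω * (2 * D ω - 2 * cellProb st ω + 1 +
        (∑ ω', cellProb st ω' ^ 2 - 2 * ∑ ω', cellProb st ω' * D ω')) =
      2 * (cellProb st ω * D ω) - 2 * cellProb st ω ^ 2 + cellProb st ω * (1 +
        (∑ ω', cellProb st ω' ^ 2 - 2 * ∑ ω', cellProb st ω' * D ω')) := by ring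
  rw [Finset.sum_congr rfl fun ω _ => (congrArg (cellProb st ω * ·) (key ω)).trans (h ω)]
  simp only [Finset.sum_add_distrib, Finset.sum_sub_distrib, ← Finset.mul_sum,
    ← Finset.sum_mul, sum_cellProb, sum_cellProb_sq]
  ring

/-- The total squared deviation over all settings and cells. -/
noncomputable def energy (D : ℕ × ℕ → Sign × Sign → ℝ) : ℝ := ∑ st ∈ ThetaF, ∑ ω, D st ω ^ 2

lemma energy_nonneg (D : ℕ × ℕ → Sign × Sign → ℝ) : 0 ≤ energy D :=
  Finset.sum_nonneg fun _ _ => Finset.sum_nonneg fun _ _ => sq_nonneg _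

lemma sq_le_energy (D : ℕ × ℕ → Sign × Sign → ℝ) {st : ℕ × ℕ} (hst : st ∈ ThetaF)
    (ω : Sign × Sign) : D st ω ^ 2 ≤ energy D :=
  (Finset.single_le_sum (f := fun ω => D st ω ^ 2) (fun _ _ => sq_nonneg _)
      (Finset.mem_univ ω)).trans
    (Finset.single_le_sum (f := fun st => ∑ ω, D st ω ^ 2)
      (fun _ _ => Finset.sum_nonneg fun _ _ => sq_nonneg _) hst)

lemma energy_update_sub (D : ℕ × ℕ → Sign × Sign → ℝ) {st : ℕ × ℕ} (hst : st ∈ ThetaF)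
    (v : Sign × Sign → ℝ) :
    energy (Function.update D st v) - energy D = ∑ ω, v ω ^ 2 - ∑ ω, D st ω ^ 2 := by
  unfold energy
  have h : ∑ x ∈ ThetaF.erase st, ∑ ω, Function.update D st v x ω ^ 2 =
      ∑ x ∈ ThetaF.erase st, ∑ ω, D x ω ^ 2 :=
    Finset.sum_congr rfl fun x hx => by rw [Function.update_of_ne (Finset.ne_of_mem_erase hx)]
  rw [← Finset.add_sum_erase _ _ hst, ← Finset.add_sum_erase ThetaF (fun st => ∑ ω, D st ω ^ 2) hst,
    h, Function.update_self]
  ring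

/-- The bookkeeping of Scientist AB: elapsed rounds, centred outcome counts, and capital. -/
structure GameState where
  time : ℕ
  dev : ℕ × ℕ → Sign × Sign → ℝ
  capital : ℝ

namespace GameState

/-- The state before the first round. -/
def init : GameState := ⟨0, 0, 1⟩

/-- The state after observing outcome `ω` under setting `st`; the capital changes by the
compensated increase of the energy, weighted by `1 / ((n + 1) (n + 2))`. -/
noncomputable def next (s : GameState) (st : ℕ × ℕ) (ω : Sign × Sign) : GameState where
  time := s.time + 1
  dev := Function.update s.dev st fun ω' => s.dev st ω' + centered st ω ω'
  capital := s.capital +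
    (energy (Function.update s.dev st fun ω' => s.dev st ω' + centered st ω ω') - energy s.dev -
      5 / 8) / ((s.time + 1) * (s.time + 2))

/-- The capital in excess of the current weighted energy. -/
noncomputable def reserve (s : GameState) : ℝ :=
  s.capital - energy s.dev / ((s.time + 1) * (s.time + 2))

lemma reserve_init : init.reserve = 1 := by
  simp [reserve, init, energy]

lemma reserve_le_capital (s : GameState) : s.reserve ≤ s.capital := by
  have := energy_nonneg s.dev
  have : 0 ≤ energy s.dev / ((s.time + 1) * (s.time + 2)) := by positivity
  unfold reserve; linarith

lemma reserve_next (s : GameState) (st : ℕ × ℕ) (ω : Sign × Sign) :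
    s.reserve - 1 / (s.time + 1) + 1 / (s.time + 2) +
      2 * energy (s.next st ω).dev / ((s.time + 1) * (s.time + 2) * (s.time + 3)) ≤
      (s.next st ω).reserve := by
  have h : (s.next st ω).reserve - (s.reserve - 1 / (s.time + 1) + 1 / (s.time + 2) +
      2 * energy (s.next st ω).dev / ((s.time + 1) * (s.time + 2) * (s.time + 3))) =
      3 / 8 / ((s.time + 1) * (s.time + 2)) := by
    simp only [reserve, next]
    push_cast
    field_simp
    ring
  have : (0 : ℝ) ≤ 3 / 8 / ((s.time + 1) * (s.time + 2)) := by positivity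
  linarith

/-- A state whose reserve is at least `1 / (n + 1)` after `n` rounds. -/
def Solvent (s : GameState) : Prop := 1 / ((s.time : ℝ) + 1) ≤ s.reserve

lemma Solvent.capital_pos {s : GameState} (h : s.Solvent) : 0 < s.capital :=
  lt_of_lt_of_le (by positivity) (le_trans h s.reserve_le_capital)

lemma Solvent.next {s : GameState} (h : s.Solvent) (st : ℕ × ℕ) (ω : Sign × Sign) :
    (s.next st ω).Solvent := by
  have h1 := s.reserve_next st ω
  have := energy_nonneg (s.next st ω).dev
  have h2 : 0 ≤ 2 * energy (s.next st ω).dev /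
    ((s.time + 1) * (s.time + 2) * (s.time + 3)) := by positivity
  have h3 : (((s.next st ω).time : ℕ) : ℝ) + 1 = s.time + 2 := by
    simp only [GameState.next]; push_cast; ring
  unfold Solvent at *
  rw [h3]
  linarith

lemma expected_capital (s : GameState) {st : ℕ × ℕ} (hst : st ∈ ThetaF) :
    ∑ ω, cellProb st ω * (s.next st ω).capital = s.capital := by
  have h (ω : Sign × Sign) : cellProb st ω * (s.next st ω).capital =
      cellProb st ω * (s.capital - 5 / 8 / ((s.time + 1) * (s.time + 2))) +
      cellProb st ω * (∑ ω', (s.dev st ω' + centered st ω ω') ^ 2 - ∑ ω', s.dev st ω' ^ 2) *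
        (1 / ((s.time + 1) * (s.time + 2))) := by
    simp only [next, energy_update_sub _ hst]
    ring
  simp only [h, Finset.sum_add_distrib, ← Finset.sum_mul, expected_sq_increase, sum_cellProb]
  ring

/-- The bets that turn the capital of `s` into that of `s.next st (a, b)`. -/
noncomputable def bet (s : GameState) (st : ℕ × ℕ) (a b : Sign) : ℝ :=
  cellProb st (a, b) * (s.next st (a, b)).capital / s.capital

lemma Solvent.bet_pos {s : GameState} (h : s.Solvent) (st : ℕ × ℕ) (a b : Sign) :
    0 < s.bet st a b :=
  div_pos (mul_pos (cellProb_pos _ _) (h.next _ _).capital_pos) h.capital_pos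

lemma Solvent.sum_bet {s : GameState} (h : s.Solvent) {st : ℕ × ℕ} (hst : st ∈ ThetaF) :
    ∑ a, ∑ b, s.bet st a b = 1 := by
  rw [← Fintype.sum_prod_type']
  simp only [bet, ← Finset.sum_div, Prod.mk.eta]
  rw [s.expected_capital hst, div_self h.capital_pos.ne']

lemma Solvent.bet_lt_one {s : GameState} (h : s.Solvent) {st : ℕ × ℕ} (hst : st ∈ ThetaF)
    (a b : Sign) : s.bet st a b < 1 := by
  obtain ⟨b', hb'⟩ : ∃ b' : Sign, b' ≠ b := by revert b; decide
  have hsum := h.sum_bet hst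
  rw [← Fintype.sum_prod_type'] at hsum
  rw [← hsum]
  exact Finset.single_lt_sum (f := fun x : Sign × Sign => s.bet st x.1 x.2)
    (i := (a, b)) (j := (a, b')) (by simpa using hb')
    (Finset.mem_univ _) (Finset.mem_univ _) (h.bet_pos _ _ _) fun _ _ _ => (h.bet_pos _ _ _).le

end GameState

/-- The cyclic choice of settings. -/
def cyclicSetting (m : ℕ) : ℕ × ℕ := (1 + m % 2, 3 + m / 2 % 2)

lemma cyclicSetting_mem (m : ℕ) : cyclicSetting m ∈ ThetaF := by
  simp only [cyclicSetting, ThetaF, Finset.mem_product, Finset.mem_insert, Finset.mem_singleton]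
  omega

lemma exists_cyclicSetting_eq_iff {st : ℕ × ℕ} (hst : st ∈ ThetaF) :
    ∃ r < 4, ∀ m, cyclicSetting m = st ↔ m % 4 = r := by
  obtain ⟨s, t⟩ := st
  simp only [ThetaF, Finset.mem_product, Finset.mem_insert, Finset.mem_singleton] at hst
  refine ⟨(s - 1) + 2 * (t - 3), by omega, fun m => ?_⟩
  simp only [cyclicSetting, Prod.mk.injEq]
  omega

/-- The bookkeeping after the history `h` when settings are chosen cyclically. -/
noncomputable def stateAfter {Λ : Type*} (X : ℕ → Λ → Sign) (h : List Λ) : GameState :=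
  h.foldl (fun s l => s.next (cyclicSetting s.time)
    (X (cyclicSetting s.time).1 l, X (cyclicSetting s.time).2 l)) GameState.init

lemma stateAfter_append {Λ : Type*} (X : ℕ → Λ → Sign) (h : List Λ) (l : Λ) :
    stateAfter X (h ++ [l]) = (stateAfter X h).next (cyclicSetting (stateAfter X h).time)
      (X (cyclicSetting (stateAfter X h).time).1 l,
        X (cyclicSetting (stateAfter X h).time).2 l) := by
  simp [stateAfter]

lemma stateAfter_solvent {Λ : Type*} (X : ℕ → Λ → Sign) (h : List Λ) :
    (stateAfter X h).Solvent := by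
  induction h using List.reverseRecOn with
  | nil =>
    change 1 / (((0 : ℕ) : ℝ) + 1) ≤ GameState.init.reserve
    simp [GameState.reserve_init]
  | append_singleton h l ih => rw [stateAfter_append]; exact ih.next _ _

lemma stateAfter_time {Λ : Type*} (X : ℕ → Λ → Sign) (h : List Λ) :
    (stateAfter X h).time = h.length := by
  induction h using List.reverseRecOn with
  | nil => rfl
  | append_singleton h l ih => simp [stateAfter_append, GameState.next, ih]

lemma hist_succ {Λ : Type*} (lam : ℕ → Λ) (m : ℕ) :
    hist lam (m + 1) = hist lam m ++ [lam (m + 1)] := by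
  simp [hist, List.range_succ]

lemma hist_length {Λ : Type*} (lam : ℕ → Λ) (m : ℕ) : (hist lam m).length = m := by
  simp [hist]

/-- A sequence with increments bounded by one and `∑ f(j)² / j³ < ∞` is `o(n)`. -/
lemma tendsto_div_of_bounded_sum {f : ℕ → ℝ} (f_zero : f 0 = 0)
    (f_step : ∀ n, |f (n + 1) - f n| ≤ 1) {B : ℝ}
    (hB : ∀ n, ∑ j ∈ Finset.range n, f j ^ 2 / ((j : ℝ) * (j + 1) * (j + 2)) ≤ B) :
    Tendsto (fun n : ℕ => f n / n) atTop (nhds 0) := by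
  set t : ℕ → ℝ := fun j => f j ^ 2 / ((j : ℝ) * (j + 1) * (j + 2)) with ht
  have t_nonneg (j : ℕ) : 0 ≤ t j := by simp only [ht]; positivity
  have hdrift (n k : ℕ) : |f (n + k) - f n| ≤ k := by
    induction k with
    | zero => simp
    | succ k ih =>
      have h1 := f_step (n + k)
      have h2 := abs_sub_le (f (n + k + 1)) (f (n + k)) (f n)
      push_cast
      rw [← add_assoc]
      linarith
  have htail : Tendsto (fun n : ℕ => 192 * (∑ j ∈ Finset.range (2 * n + 1), t j -
      ∑ j ∈ Finset.range n, t j)) atTop (nhds 0) := by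
    have hs : Summable t := summable_of_sum_range_le t_nonneg hB
    have hlim := hs.hasSum.tendsto_sum_nat
    have hsub : Tendsto (fun n : ℕ => 2 * n + 1) atTop atTop :=
      tendsto_atTop_mono (fun n => (by omega : n ≤ 2 * n + 1)) tendsto_id
    simpa using ((hlim.comp hsub).sub hlim).const_mul 192
  have hcube (n : ℕ) (hn : 1 ≤ n) : |f n / n| ^ 3 ≤
      192 * (∑ j ∈ Finset.range (2 * n + 1), t j - ∑ j ∈ Finset.range n, t j) := by
    have hn' : (1 : ℝ) ≤ n := by exact_mod_cast hn
    set x := |f n| with hx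
    have x_nonneg : 0 ≤ x := abs_nonneg _
    have x_le : x ≤ n := by simpa [f_zero] using hdrift 0 n
    set k := ⌊x / 2⌋₊
    have k_le : (k : ℝ) ≤ x / 2 := Nat.floor_le (by positivity)
    have lt_k : x / 2 < k + 1 := Nat.lt_floor_add_one _
    have k_le_n : k ≤ n := by
      have : (k : ℝ) ≤ n := by linarith
      exact_mod_cast this
    have hterm : ∀ i ∈ Finset.range (k + 1), (x / 2) ^ 2 / (24 * (n : ℝ) ^ 3) ≤ t (n + i) := by
      intro i hi
      have hi' : (i : ℝ) ≤ k := by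
        exact_mod_cast Nat.lt_succ_iff.mp (Finset.mem_range.mp hi)
      have h1 := hdrift n i
      have h2 : x ≤ |f (n + i)| + |f (n + i) - f n| := by
        have := abs_sub_abs_le_abs_sub (f n) (f (n + i))
        rw [abs_sub_comm] at this
        linarith
      have h3 : (x / 2) ^ 2 ≤ f (n + i) ^ 2 := by
        rw [← sq_abs (f (n + i))]
        exact pow_le_pow_left₀ (by positivity) (by linarith) 2
      have h4 : ((n + i : ℕ) : ℝ) ≤ 2 * n := by push_cast; linarith
      have h5 : ((n + i : ℕ) : ℝ) * ((n + i : ℕ) + 1) * ((n + i : ℕ) + 2) ≤ 24 * (n : ℝ) ^ 3 := by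
        calc ((n + i : ℕ) : ℝ) * ((n + i : ℕ) + 1) * ((n + i : ℕ) + 2)
            ≤ (2 * n) * (3 * n) * (4 * n) := by gcongr <;> linarith
          _ = 24 * (n : ℝ) ^ 3 := by ring
      have h6 : (0 : ℝ) < ((n + i : ℕ) : ℝ) * ((n + i : ℕ) + 1) * ((n + i : ℕ) + 2) := by
        have : (0 : ℝ) < ((n + i : ℕ) : ℝ) := by push_cast; positivity
        positivity
      exact div_le_div₀ (sq_nonneg _) h3 h6 h5
    have hwin : ∑ i ∈ Finset.range (k + 1), t (n + i) ≤
        ∑ j ∈ Finset.range (2 * n + 1), t j - ∑ j ∈ Finset.range n, t j := by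
      have h1 := Finset.sum_range_add t n (k + 1)
      have h2 : ∑ j ∈ Finset.range (n + (k + 1)), t j ≤ ∑ j ∈ Finset.range (2 * n + 1), t j :=
        Finset.sum_le_sum_of_subset_of_nonneg (Finset.range_mono (by omega))
          fun _ _ _ => t_nonneg _
      linarith
    have hsum := Finset.card_nsmul_le_sum _ _ _ hterm
    rw [Finset.card_range, nsmul_eq_mul] at hsum
    push_cast at hsum
    have hc : x / 2 * ((x / 2) ^ 2 / (24 * (n : ℝ) ^ 3)) ≤
        (k + 1) * ((x / 2) ^ 2 / (24 * (n : ℝ) ^ 3)) := by gcongr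
    have he : |f n / n| ^ 3 = 192 * (x / 2 * ((x / 2) ^ 2 / (24 * (n : ℝ) ^ 3))) := by
      rw [abs_div, Nat.abs_cast, ← hx]
      field_simp
      ring
    rw [he]
    linarith
  have h3 : Tendsto (fun n : ℕ => |f n / n| ^ 3) atTop (nhds 0) :=
    squeeze_zero' (Eventually.of_forall fun n => by positivity)
      (eventually_atTop.2 ⟨1, hcube⟩) htail
  rw [Metric.tendsto_atTop] at h3 ⊢
  intro ε hε
  obtain ⟨N, hN⟩ := h3 (ε ^ 3) (by positivity)
  refine ⟨N, fun n hn => ?_⟩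
  have := hN n hn
  rw [Real.dist_eq, sub_zero, abs_of_nonneg (by positivity)] at this
  rw [Real.dist_eq, sub_zero]
  exact lt_of_pow_lt_pow_left₀ 3 hε.le this

lemma card_filter_Icc_succ (P : ℕ → Prop) [DecidablePred P] (n : ℕ) :
    ((Finset.Icc 1 (n + 1)).filter P).card =
      ((Finset.Icc 1 n).filter P).card + if P (n + 1) then 1 else 0 := by
  rw [Finset.card_filter, Finset.card_filter, Finset.sum_Icc_succ_top (by omega)]

lemma card_filter_mod_four {r : ℕ} (hr : r < 4) (n : ℕ) :
    n ≤ 4 * ((Finset.Icc 1 n).filter fun i => (i - 1) % 4 = r).card + 3 := by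
  suffices h : ((Finset.Icc 1 n).filter fun i => (i - 1) % 4 = r).card = (n + 3 - r) / 4 by
    omega
  induction n with
  | zero => simp; omega
  | succ n ih =>
    rw [card_filter_Icc_succ, ih, Nat.add_sub_cancel]
    split_ifs <;> omega

section Play

variable {Λ : Type*} (X : ℕ → Λ → Sign) (lam : ℕ → Λ)

lemma stateAfter_hist_succ (n : ℕ) :
    stateAfter X (hist lam (n + 1)) = (stateAfter X (hist lam n)).next (cyclicSetting n)
      (X (cyclicSetting n).1 (lam (n + 1)), X (cyclicSetting n).2 (lam (n + 1))) := by
  rw [hist_succ, stateAfter_append, stateAfter_time, hist_length]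

lemma weighted_energy_le_capital (n : ℕ) :
    ∑ j ∈ Finset.range (n + 1), 2 * energy (stateAfter X (hist lam j)).dev /
      ((j : ℝ) * (j + 1) * (j + 2)) ≤ (stateAfter X (hist lam n)).capital := by
  refine le_trans ?_ (GameState.reserve_le_capital _)
  suffices h : 1 / ((n : ℝ) + 1) + ∑ j ∈ Finset.range (n + 1),
      2 * energy (stateAfter X (hist lam j)).dev / ((j : ℝ) * (j + 1) * (j + 2)) ≤
      (stateAfter X (hist lam n)).reserve by
    have : 0 < 1 / ((n : ℝ) + 1) := by positivity
    linarith
  induction n with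
  | zero => simp [hist, stateAfter, GameState.reserve_init]
  | succ n ih =>
    have h := (stateAfter X (hist lam n)).reserve_next (cyclicSetting n)
      (X (cyclicSetting n).1 (lam (n + 1)), X (cyclicSetting n).2 (lam (n + 1)))
    rw [← stateAfter_hist_succ, stateAfter_time, hist_length] at h
    rw [Finset.sum_range_succ]
    push_cast
    rw [show (n : ℝ) + 1 + 1 = n + 2 by ring, show (n : ℝ) + 1 + 2 = n + 3 by ring]
    linarith

lemma abs_dev_succ_sub_le (st : ℕ × ℕ) (ω : Sign × Sign) (n : ℕ) :
    |(stateAfter X (hist lam (n + 1))).dev st ω - (stateAfter X (hist lam n)).dev st ω| ≤ 1 := by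
  rw [stateAfter_hist_succ]
  simp only [GameState.next]
  by_cases h : st = cyclicSetting n
  · subst h
    simpa using abs_centered_le _ _ _
  · simp [Function.update_of_ne h]

lemma dev_eq_card_sub {setting : ℕ → ℕ × ℕ}
    (hsetting : ∀ n, setting (n + 1) = cyclicSetting n) (st : ℕ × ℕ) (a b : Sign) (n : ℕ) :
    (stateAfter X (hist lam n)).dev st (a, b) =
      (((Finset.Icc 1 n).filter fun i =>
        X (setting i).1 (lam i) = a ∧ X (setting i).2 (lam i) = b ∧ setting i = st).card : ℝ) -
      chshP a b st.1 st.2 * (((Finset.Icc 1 n).filter fun i => setting i = st).card : ℝ) := by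
  induction n with
  | zero => simp [hist, stateAfter, GameState.init]
  | succ n ih =>
    rw [card_filter_Icc_succ, card_filter_Icc_succ, stateAfter_hist_succ, hsetting]
    simp only [GameState.next]
    by_cases h : st = cyclicSetting n
    · subst h
      rw [Function.update_self, ih]
      simp only [centered, cellProb, Prod.mk.injEq, and_true, if_true, eq_comm (a := a),
        eq_comm (a := b)]
      push_cast
      ring
    · rw [Function.update_of_ne h, ih]
      simp [Ne.symm h]

end Play

/-- **Forcing the CHSH table in the hidden-variable game with loopholes closed.**
Scientist AB has a strategy (bets `{qₙ(·,·|s,t)}_{(s,t)∈Θ}` and setting pair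
`(sₙ,tₙ) ∈ Θ`, as functions of the history `λ₁,…,λₙ₋₁`) choosing every setting
pair infinitely often, such that for every sequence of Nature's moves `λ`, with
outcomes `(ωₙ^{sₙ}, ωₙ^{tₙ}) = (X_{sₙ}(λₙ), X_{tₙ}(λₙ))` and capital
`Kₙ = Kₙ₋₁ · qₙ(ωₙ^{sₙ},ωₙ^{tₙ}|sₙ,tₙ)/p(ωₙ^{sₙ},ωₙ^{tₙ}|sₙ,tₙ)`: either
`Kₙ → ∞`, or all conditional empirical frequencies converge to the CHSH table. -/
theorem loopholes_closed_game_forcing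
    {Λ : Type*} (X : ℕ → Λ → Sign)
    (hsurj : Function.Surjective fun l : Λ => (X 1 l, X 2 l, X 3 l, X 4 l)) :
    ∃ strat : List Λ → ((ℕ × ℕ) → Sign → Sign → ℝ) × (ℕ × ℕ),
      (∀ h, (strat h).2 ∈ ThetaF ∧
        ∀ st ∈ ThetaF, (∀ a b : Sign, (strat h).1 st a b ∈ Set.Ioo (0 : ℝ) 1) ∧
          ∑ a : Sign, ∑ b : Sign, (strat h).1 st a b = 1) ∧
      ∀ lam : ℕ → Λ, ∀ setting : ℕ → ℕ × ℕ,
        (∀ n, 1 ≤ n → setting n = (strat (hist lam (n - 1))).2) →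
        ((∀ st ∈ ThetaF, ∀ N, ∃ n ≥ N, 1 ≤ n ∧ setting n = st) ∧
          ∀ K : ℕ → ℝ, K 0 = 1 →
            (∀ n, 1 ≤ n → K n = K (n - 1) *
                (strat (hist lam (n - 1))).1 (setting n)
                  (X (setting n).1 (lam n)) (X (setting n).2 (lam n)) /
                chshP (X (setting n).1 (lam n)) (X (setting n).2 (lam n))
                  (setting n).1 (setting n).2) →
            (Tendsto K atTop atTop ∨
              ∀ st ∈ ThetaF, ∀ a b : Sign,
                Tendsto (fun n =>
                    (((Finset.Icc 1 n).filter fun i =>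
                        X (setting i).1 (lam i) = a ∧ X (setting i).2 (lam i) = b ∧
                          setting i = st).card : ℝ) /
                    (((Finset.Icc 1 n).filter fun i => setting i = st).card : ℝ))
                  atTop (nhds (chshP a b st.1 st.2)))) := by
  refine ⟨fun h => ((stateAfter X h).bet, cyclicSetting h.length), fun h =>
    ⟨cyclicSetting_mem _, fun st hst => ⟨fun a b => ⟨(stateAfter_solvent X h).bet_pos st a b,
      (stateAfter_solvent X h).bet_lt_one hst a b⟩, (stateAfter_solvent X h).sum_bet hst⟩⟩, ?_⟩
  intro lam setting hset
  have hsetting (n : ℕ) : setting (n + 1) = cyclicSetting n := by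
    simpa [hist_length] using hset (n + 1) (by omega)
  refine ⟨fun st hst N => ?_, fun K K_zero hK => ?_⟩
  · obtain ⟨r, hr, hiff⟩ := exists_cyclicSetting_eq_iff hst
    refine ⟨4 * N + r + 1, by omega, by omega, ?_⟩
    rw [hsetting, hiff]
    omega
  set T : ℕ → ℝ := fun n => ∑ j ∈ Finset.range n, 2 * energy (stateAfter X (hist lam j)).dev /
    ((j : ℝ) * (j + 1) * (j + 2)) with hT
  have K_eq (n : ℕ) : K n = (stateAfter X (hist lam n)).capital := by
    induction n with
    | zero => simpa [hist, stateAfter, GameState.init] using K_zero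
    | succ n ih =>
      have h := hK (n + 1) (by omega)
      rw [Nat.add_sub_cancel, hsetting, ih] at h
      rw [h, stateAfter_hist_succ]
      have h1 := (stateAfter_solvent X (hist lam n)).capital_pos.ne'
      have h2 := (cellProb_pos (cyclicSetting n)
        (X (cyclicSetting n).1 (lam (n + 1)), X (cyclicSetting n).2 (lam (n + 1)))).ne'
      simp only [GameState.bet]
      simp only [cellProb] at h2 ⊢
      field_simp
  have T_mono : Monotone T := by
    refine monotone_nat_of_le_succ fun n => ?_
    simp only [hT, Finset.sum_range_succ]
    have := energy_nonneg (stateAfter X (hist lam n)).dev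
    exact le_add_of_nonneg_right (by positivity)
  have T_le (n : ℕ) : T n ≤ K n := by
    rw [K_eq]
    exact (T_mono (Nat.le_succ n)).trans (weighted_energy_le_capital X lam n)
  rcases tendsto_atTop_of_monotone T_mono with hdiv | ⟨B, hconv⟩
  · exact Or.inl (tendsto_atTop_mono T_le hdiv)
  refine Or.inr fun st hst a b => ?_
  have hdev : Tendsto (fun n : ℕ => (stateAfter X (hist lam n)).dev st (a, b) / n) atTop
      (nhds 0) := by
    refine tendsto_div_of_bounded_sum (B := B) rfl (abs_dev_succ_sub_le X lam st (a, b))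
      fun n => (Finset.sum_le_sum fun j _ => ?_).trans (T_mono.ge_of_tendsto hconv n)
    have h1 := sq_le_energy (stateAfter X (hist lam j)).dev hst (a, b)
    have h2 := energy_nonneg (stateAfter X (hist lam j)).dev
    gcongr
    linarith
  obtain ⟨r, hr, hiff⟩ := exists_cyclicSetting_eq_iff hst
  set N : ℕ → ℕ := fun n => ((Finset.Icc 1 n).filter fun i => setting i = st).card with hN
  have hcount (n : ℕ) : n ≤ 4 * N n + 3 := by
    have h : (Finset.Icc 1 n).filter (fun i => setting i = st) =
        (Finset.Icc 1 n).filter fun i => (i - 1) % 4 = r := by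
      refine Finset.filter_congr fun i hi => ?_
      obtain ⟨m, rfl⟩ := Nat.exists_eq_add_of_le' (Finset.mem_Icc.mp hi).1
      rw [hsetting, hiff, Nat.add_sub_cancel]
    simp only [hN, h]
    exact card_filter_mod_four hr n
  rw [tendsto_iff_norm_sub_tendsto_zero]
  have hbound : Tendsto (fun n : ℕ => 7 * |(stateAfter X (hist lam n)).dev st (a, b) / n|) atTop
      (nhds 0) := by simpa using hdev.abs.const_mul 7
  refine squeeze_zero' (Eventually.of_forall fun n => norm_nonneg _)
    (eventually_atTop.2 ⟨4, fun n hn => ?_⟩) hbound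
  have N_pos : 0 < N n := by have := hcount n; omega
  have N_pos' : (0 : ℝ) < N n := by exact_mod_cast N_pos
  have n_pos : (0 : ℝ) < n := by exact_mod_cast (by omega : 0 < n)
  have hn7 : (n : ℝ) ≤ 7 * N n := by
    have : n ≤ 7 * N n := by have := hcount n; omega
    exact_mod_cast this
  have hdev_eq := dev_eq_card_sub X lam hsetting st a b n
  change _ = _ - _ * (N n : ℝ) at hdev_eq
  change ‖_ / (N n : ℝ) - _‖ ≤ _
  rw [Real.norm_eq_abs, div_sub' N_pos'.ne', mul_comm (N n : ℝ), ← hdev_eq, abs_div, abs_div,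
    abs_of_pos N_pos', abs_of_pos n_pos, ← mul_div_assoc, div_le_div_iff₀ N_pos' n_pos]
  nlinarith [abs_nonneg ((stateAfter X (hist lam n)).dev st (a, b))]
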